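/- For every real z with 0 < z < 1, the hypergeometric values F(1/12,5/12,1/2;1−z) and F(1/12,5/12,1;z) are positive real numbers, Re φ₂(z) = 0, and Im φ₂(z) > 1. Moreover Im φ₂(z) → +∞ as z → 0⁺ along (0,1), and φ₂(z) → i as z → 1⁻ along (0,1). -/

import Mathlib

open Complex

/-- Gauss hypergeometric series `F(a,b,c;z) = ∑ (a)_n (b)_n / ((c)_n n!) zⁿ`. -/
noncomputable def hyperF (a b c z : ℂ) : ℂ :=
  ∑' n : ℕ, ((∏ k ∈ Finset.range n, (a + k)) * (∏ k ∈ Finset.range n, (b + k)) /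
    ((∏ k ∈ Finset.range n, (c + k)) * (n.factorial : ℂ))) * z ^ n

/-- The beta function `B(x,y) = Γ(x)Γ(y)/Γ(x+y)`. -/
noncomputable def betaFn (x y : ℂ) : ℂ :=
  Complex.Gamma x * Complex.Gamma y / Complex.Gamma (x + y)

/-- Schwarz's map `φ₂` for `(a,b,c) = (1/12,5/12,1)`. -/
noncomputable def phi2 (z : ℂ) : ℂ :=
  Complex.I * (betaFn (1/12) (5/12) / (2 * Real.pi)) *
    hyperF (1/12) (5/12) (1/2) (1 - z) / hyperF (1/12) (5/12) 1 z - Complex.I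

/-- Rising factorial. -/
noncomputable def cpo (a : ℝ) (n : ℕ) : ℝ := ∏ k ∈ Finset.range n, (a + k)

lemma cpo_pos {a : ℝ} (ha : 0 < a) (n : ℕ) : 0 < cpo a n :=
  Finset.prod_pos fun k _ => by positivity

lemma cpo_succ (a : ℝ) (n : ℕ) : cpo a (n+1) = cpo a n * (a + n) := Finset.prod_range_succ _ _

lemma cpo_zero (a : ℝ) : cpo a 0 = 1 := Finset.prod_range_zero _

lemma cpo_one (n : ℕ) : cpo 1 n = n.factorial := by
  induction n with
  | zero => simp [cpo_zero]
  | succ n ih => rw [cpo_succ, ih, Nat.factorial_succ]; push_cast; ring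

lemma Gamma_add_cpo {b : ℝ} (hb : 0 < b) (n : ℕ) :
    Real.Gamma (b + n) = cpo b n * Real.Gamma b := by
  induction n with
  | zero => simp [cpo_zero]
  | succ n ih =>
    have : b + ((n+1 : ℕ) : ℝ) = (b + n) + 1 := by push_cast; ring
    rw [this, Real.Gamma_add_one (by positivity), ih, cpo_succ]; ring

lemma ascPoch_eval_cpo (a : ℝ) (n : ℕ) : (ascPochhammer ℝ n).eval a = cpo a n := by
  induction n with
  | zero => simp [cpo_zero]
  | succ n ih => rw [ascPochhammer_succ_eval, ih, cpo_succ]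

lemma choose_cpo (a : ℝ) (n : ℕ) : Ring.choose (a + n - 1) n = cpo a n / n.factorial := by
  rw [Ring.choose_eq_smul, Polynomial.descPochhammer_smeval_eq_ascPochhammer,
    Polynomial.ascPochhammer_smeval_cast, Polynomial.ascPochhammer_smeval_eq_eval,
    show a + (n:ℝ) - 1 - n + 1 = a by ring, ascPoch_eval_cpo, smul_eq_mul]
  field_simp

lemma hasSum_binom (a : ℝ) {t : ℝ} (h0 : 0 < t) (h1 : t < 1) :
    HasSum (fun n : ℕ => cpo a n / n.factorial * t ^ n) ((1 - t) ^ (-a)) := by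
  have h := (Real.one_div_one_sub_rpow_hasFPowerSeriesOnBall_zero a).hasSum (y := t) (by
    rw [← ENNReal.ofReal_one, Metric.eball_ofReal]
    simpa [abs_of_pos h0] using h1)
  rw [Real.rpow_neg (by linarith)]
  simpa [choose_cpo, FormalMultilinearSeries.ofScalars, mul_comm] using h

lemma lint_beta {α β : ℝ} (hα : 0 < α) (hβ : 0 < β) :
    ∫⁻ x in Set.Ioo (0:ℝ) 1, ENNReal.ofReal (x ^ (α - 1) * (1 - x) ^ (β - 1)) =
      ENNReal.ofReal (Real.Gamma α * Real.Gamma β / Real.Gamma (α + β)) := by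
  have h := ProbabilityTheory.lintegral_betaPDF_eq_one hα hβ
  rw [ProbabilityTheory.lintegral_betaPDF] at h
  have hb := ProbabilityTheory.beta_pos hα hβ
  have e : ∀ x : ℝ, ENNReal.ofReal (x ^ (α - 1) * (1 - x) ^ (β - 1)) =
      ENNReal.ofReal (ProbabilityTheory.beta α β) *
      ENNReal.ofReal (1 / ProbabilityTheory.beta α β * x ^ (α - 1) * (1 - x) ^ (β - 1)) := by
    intro x
    rw [← ENNReal.ofReal_mul hb.le]
    congr 1
    field_simp
  simp_rw [e]
  rw [MeasureTheory.lintegral_const_mul _ (by fun_prop), h, mul_one]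
  rfl

/-- Gauss summation with `c = 1`. -/
lemma gauss_sum {a b : ℝ} (ha : 0 < a) (hb : 0 < b) (hab : a + b < 1) :
    HasSum (fun n : ℕ => cpo a n * cpo b n / (cpo 1 n * n.factorial))
      (Real.Gamma (1 - a - b) / (Real.Gamma (1 - a) * Real.Gamma (1 - b))) := by
  have gb := Real.Gamma_pos_of_pos hb
  have g1b : 0 < Real.Gamma (1 - b) := Real.Gamma_pos_of_pos (by linarith)
  have g1a : 0 < Real.Gamma (1 - a) := Real.Gamma_pos_of_pos (by linarith)
  have gab : 0 < Real.Gamma (1 - a - b) := Real.Gamma_pos_of_pos (by linarith)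
  have pa := fun n => cpo_pos ha n
  have pb := fun n => cpo_pos hb n
  set u : ℕ → ℝ := fun n : ℕ => cpo a n * cpo b n / (cpo 1 n * n.factorial) with hu
  have up : ∀ n, 0 ≤ u n := fun n => by
    have := cpo_pos one_pos n
    have := pa n
    have := pb n
    simp only [hu]; positivity
  set C := Real.Gamma b * Real.Gamma (1 - b) with hC
  have hCp : 0 < C := by positivity
  have key : ∑' n, ENNReal.ofReal (C * u n) =
      ENNReal.ofReal (Real.Gamma b * Real.Gamma (1 - a - b) / Real.Gamma (1 - a)) := by
    have h1 := lint_beta (α := b) (β := 1 - a - b) hb (by linarith)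
    rw [show b + (1 - a - b) = 1 - a by ring] at h1
    rw [← h1]
    have h2 : ∀ n : ℕ, ENNReal.ofReal (C * u n) = ∫⁻ x in Set.Ioo (0:ℝ) 1,
        ENNReal.ofReal (cpo a n / n.factorial) *
        ENNReal.ofReal (x ^ (b + n - 1) * (1 - x) ^ ((1 - b) - 1)) := by
      intro n
      rw [MeasureTheory.lintegral_const_mul _ (by fun_prop),
        lint_beta (by positivity) (by linarith), ← ENNReal.ofReal_mul (by have := pa n; positivity)]
      congr 1
      rw [show b + (n:ℝ) + (1 - b) = n + 1 by ring, Real.Gamma_nat_eq_factorial, Gamma_add_cpo hb]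
      simp only [hu, hC, cpo_one]
      ring
    simp_rw [h2]
    rw [← MeasureTheory.lintegral_tsum (fun n => by fun_prop)]
    apply MeasureTheory.setLIntegral_congr_fun measurableSet_Ioo
    intro x hx
    obtain ⟨h0, h1⟩ := hx
    have hs := (hasSum_binom a h0 h1).mul_right (x ^ (b - 1) * (1 - x) ^ ((1 - b) - 1))
    have hx1 : 0 < 1 - x := by linarith
    have e1 : (1 - x) ^ (-a) * (x ^ (b - 1) * (1 - x) ^ ((1 - b) - 1)) =
        x ^ (b - 1) * (1 - x) ^ ((1 - a - b) - 1) := by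
      rw [mul_left_comm, ← Real.rpow_add hx1]; ring_nf
    rw [e1] at hs
    simp only
    rw [← hs.tsum_eq, ENNReal.ofReal_tsum_of_nonneg _ hs.summable]
    · congr 1
      ext n
      have := pa n
      rw [← ENNReal.ofReal_mul (by positivity)]
      congr 1
      rw [show b + (n:ℝ) - 1 = b - 1 + n by ring, Real.rpow_add h0, Real.rpow_natCast]
      ring
    · intro n
      have := pa n
      positivity
  have hnn : ∀ n, 0 ≤ C * u n := fun n => mul_nonneg hCp.le (up n)
  have hsum : Summable (fun n => C * u n) := by
    have : ∑' n, ENNReal.ofReal (C * u n) ≠ ⊤ := by rw [key]; exact ENNReal.ofReal_ne_top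
    have h := ENNReal.summable_toReal this
    simpa [ENNReal.toReal_ofReal (hnn _)] using h
  have htot : ∑' n, C * u n = Real.Gamma b * Real.Gamma (1 - a - b) / Real.Gamma (1 - a) := by
    rw [← ENNReal.ofReal_tsum_of_nonneg hnn hsum] at key
    exact (ENNReal.ofReal_eq_ofReal_iff (tsum_nonneg hnn) (by positivity)).1 key
  have := (htot ▸ hsum.hasSum).mul_left C⁻¹
  have e2 : (fun n => C⁻¹ * (C * u n)) = u := by ext n; field_simp
  rw [e2] at this
  have e3 : Real.Gamma (1 - a - b) / (Real.Gamma (1 - a) * Real.Gamma (1 - b)) =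
      C⁻¹ * (Real.Gamma b * Real.Gamma (1 - a - b) / Real.Gamma (1 - a)) := by
    rw [hC]; field_simp
  rw [e3]
  exact this

/-- Real coefficients of the hypergeometric series. -/
noncomputable def co (c : ℝ) (n : ℕ) : ℝ :=
  cpo (1/12) n * cpo (5/12) n / (cpo c n * n.factorial)

/-- Real hypergeometric series. -/
noncomputable def RF (c z : ℝ) : ℝ := ∑' n : ℕ, co c n * z ^ n

lemma co_pos {c : ℝ} (hc : 0 < c) (n : ℕ) : 0 < co c n := by
  have h1 := cpo_pos (a := 1/12) (by norm_num) n
  have h2 := cpo_pos (a := 5/12) (by norm_num) n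
  have h3 := cpo_pos hc n
  unfold co; positivity

lemma co_zero (c : ℝ) : co c 0 = 1 := by simp [co, cpo_zero]

lemma co_succ {c : ℝ} (hc : 0 < c) (n : ℕ) :
    co c (n+1) = co c n * ((1/12 + n) * (5/12 + n) / ((c + n) * (n + 1))) := by
  have h3 := cpo_pos hc n
  simp only [co, cpo_succ, Nat.factorial_succ]
  push_cast
  field_simp

lemma co_le_one {c : ℝ} (hc : 1/2 ≤ c) (n : ℕ) : co c n ≤ 1 := by
  have hc0 : 0 < c := by linarith
  induction n with
  | zero => rw [co_zero]
  | succ n ih =>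
    rw [co_succ hc0]
    refine mul_le_one₀ ih (by positivity) ?_
    rw [div_le_one (by positivity)]
    have : (0:ℝ) ≤ n := by positivity
    nlinarith

lemma co_ge (n : ℕ) : 5/72 / ((n:ℝ) + 1) ≤ co (1/2) (n+1) := by
  induction n with
  | zero => rw [co_succ (by norm_num), co_zero]; norm_num
  | succ n ih =>
    rw [co_succ (by norm_num)]
    refine le_trans ?_ (mul_le_mul_of_nonneg_right ih (by positivity))
    push_cast
    rw [div_mul_div_comm, div_le_div_iff₀ (by positivity) (by positivity)]
    have : (0:ℝ) ≤ n := by positivity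
    nlinarith [mul_nonneg this this, mul_nonneg this (mul_nonneg this this)]

lemma summable_RF {c z : ℝ} (hc : 1/2 ≤ c) (h0 : 0 ≤ z) (h1 : z < 1) :
    Summable (fun n : ℕ => co c n * z ^ n) := by
  have hc0 : 0 < c := by linarith
  refine Summable.of_nonneg_of_le (fun n => ?_) (fun n => ?_) (summable_geometric_of_lt_one h0 h1)
  · have := co_pos hc0 n
    positivity
  · exact mul_le_of_le_one_left (by positivity) (co_le_one hc n)

lemma one_lt_RF {c z : ℝ} (hc : 1/2 ≤ c) (h0 : 0 < z) (h1 : z < 1) : 1 < RF c z := by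
  have hc0 : 0 < c := by linarith
  have hs := summable_RF hc h0.le h1
  have h := hs.sum_le_tsum (Finset.range 2) (fun n _ => by
    have := co_pos hc0 n
    positivity)
  have h2 := co_pos hc0 1
  simp [Finset.sum_range_succ, co_zero] at h
  have : 0 < co c 1 * z := by positivity
  unfold RF
  linarith

lemma hyperF_eq (c z : ℝ) : hyperF (1/12) (5/12) (c : ℂ) (z : ℂ) = (RF c z : ℂ) := by
  unfold hyperF RF co cpo
  push_cast
  rfl

/-- The value of `F(1/12,5/12,1;1)`. -/
noncomputable def B1 : ℝ := Real.Gamma (1/2) / (Real.Gamma (11/12) * Real.Gamma (7/12))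

lemma hasSum_B1 : HasSum (co 1) B1 := by
  have h := gauss_sum (a := 1/12) (b := 5/12) (by norm_num) (by norm_num) (by norm_num)
  norm_num at h
  unfold B1 co
  norm_num
  exact h

lemma B1_pos : 0 < B1 := by
  unfold B1
  have h1 : 0 < Real.Gamma (1/2) := Real.Gamma_pos_of_pos (by norm_num)
  have h2 : 0 < Real.Gamma (11/12) := Real.Gamma_pos_of_pos (by norm_num)
  have h3 : 0 < Real.Gamma (7/12) := Real.Gamma_pos_of_pos (by norm_num)
  positivity

lemma RF_le_B1 {z : ℝ} (h0 : 0 < z) (h1 : z < 1) : RF 1 z ≤ B1 := by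
  rw [← hasSum_B1.tsum_eq]
  refine (summable_RF (by norm_num) h0.le h1).tsum_le_tsum (fun n => ?_) hasSum_B1.summable
  exact mul_le_of_le_one_right (co_pos one_pos n).le (pow_le_one₀ h0.le h1.le)

/-- The constant `B(1/12,5/12)/(2π)`. -/
noncomputable def K : ℝ :=
  Real.Gamma (1/12) * Real.Gamma (5/12) / Real.Gamma (1/2) / (2 * Real.pi)

lemma K_eq : K = 2 * B1 := by
  have h1 : 0 < Real.Gamma (1/2) := Real.Gamma_pos_of_pos (by norm_num)
  have h2 : 0 < Real.Gamma (11/12) := Real.Gamma_pos_of_pos (by norm_num)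
  have h3 : 0 < Real.Gamma (7/12) := Real.Gamma_pos_of_pos (by norm_num)
  have r1 := Real.Gamma_mul_Gamma_one_sub (1/12)
  have r2 := Real.Gamma_mul_Gamma_one_sub (5/12)
  have r3 := Real.Gamma_one_half_eq
  have hpi := Real.pi_pos
  have hsq : Real.Gamma (1/2) * Real.Gamma (1/2) = Real.pi := by
    rw [r3, Real.mul_self_sqrt hpi.le]
  rw [show (1:ℝ) - 1/12 = 11/12 by norm_num] at r1
  rw [show (1:ℝ) - 5/12 = 7/12 by norm_num,
    show Real.pi * (5/12) = Real.pi / 2 - Real.pi * (1/12) by ring, Real.sin_pi_div_two_sub] at r2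
  have s1 : Real.sin (Real.pi * (1/12)) * Real.cos (Real.pi * (1/12)) = 1/4 := by
    have := Real.sin_two_mul (Real.pi * (1/12))
    rw [show 2 * (Real.pi * (1/12)) = Real.pi / 6 by ring, Real.sin_pi_div_six] at this
    linarith
  have prod : (Real.Gamma (1/12) * Real.Gamma (5/12)) * (Real.Gamma (11/12) * Real.Gamma (7/12))
      = 4 * (Real.pi * Real.pi) := by
    have : (Real.Gamma (1/12) * Real.Gamma (5/12)) * (Real.Gamma (11/12) * Real.Gamma (7/12))
      = (Real.Gamma (1/12) * Real.Gamma (11/12)) * (Real.Gamma (5/12) * Real.Gamma (7/12)) := by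
      ring
    rw [this, r1, r2, div_mul_div_comm, s1]
    ring
  unfold K B1
  rw [div_div, ← mul_div_assoc, div_eq_div_iff (by positivity) (by positivity), prod]
  linear_combination (-4 * Real.pi) * hsq

lemma phi2_eq (z : ℝ) : phi2 (z : ℂ) =
    ((K * RF (1/2) (1 - z) / RF 1 z - 1 : ℝ) : ℂ) * Complex.I := by
  have e1 := hyperF_eq (1/2) (1 - z)
  have e2 := hyperF_eq 1 z
  push_cast at e1 e2
  have e3 : betaFn (1/12) (5/12) / (2 * Real.pi) = (K : ℂ) := by
    unfold betaFn K
    push_cast [← Complex.Gamma_ofReal]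
    norm_num
  unfold phi2
  rw [e1, e2, e3]
  push_cast
  ring

/-- Behavior of Schwarz's map `φ₂` on the interval `(0,1)`. -/
theorem phi2_on_interval :
    (∀ z : ℝ, 0 < z → z < 1 →
      ((hyperF (1/12) (5/12) (1/2) (1 - (z : ℂ))).im = 0 ∧
        0 < (hyperF (1/12) (5/12) (1/2) (1 - (z : ℂ))).re) ∧
      ((hyperF (1/12) (5/12) 1 (z : ℂ)).im = 0 ∧
        0 < (hyperF (1/12) (5/12) 1 (z : ℂ)).re) ∧
      (phi2 (z : ℂ)).re = 0 ∧ 1 < (phi2 (z : ℂ)).im) ∧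
    Filter.Tendsto (fun z : ℝ => (phi2 (z : ℂ)).im)
      (nhdsWithin 0 (Set.Ioo 0 1)) Filter.atTop ∧
    Filter.Tendsto (fun z : ℝ => phi2 (z : ℂ))
      (nhdsWithin 1 (Set.Ioo 0 1)) (nhds Complex.I) := by
  have him : ∀ z : ℝ, (phi2 (z : ℂ)).im = K * RF (1/2) (1 - z) / RF 1 z - 1 := by
    intro z
    rw [phi2_eq, Complex.im_ofReal_mul, Complex.I_im, mul_one]
  have hB := B1_pos
  -- common lower bound
  have hlow : ∀ z : ℝ, 0 < z → z < 1 → 2 * RF (1/2) (1 - z) ≤ K * RF (1/2) (1 - z) / RF 1 z := by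
    intro z h0 h1
    have hA := one_lt_RF (c := 1/2) (z := 1 - z) le_rfl (by linarith) (by linarith)
    have hD := one_lt_RF (c := 1) (by norm_num) h0 h1
    have hle := RF_le_B1 h0 h1
    rw [le_div_iff₀ (by linarith), K_eq]
    nlinarith [mul_nonneg (by linarith : (0:ℝ) ≤ RF (1/2) (1 - z)) (sub_nonneg.2 hle)]
  refine ⟨fun z h0 h1 => ?_, ?_, ?_⟩
  · have hA := one_lt_RF (c := 1/2) (z := 1 - z) le_rfl (by linarith) (by linarith)
    have hD := one_lt_RF (c := 1) (by norm_num) h0 h1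
    have e1 := hyperF_eq (1/2) (1 - z)
    have e2 := hyperF_eq 1 z
    push_cast at e1 e2
    have hl := hlow z h0 h1
    refine ⟨?_, ?_, ?_, ?_⟩
    · rw [e1]
      exact ⟨Complex.ofReal_im _, by rw [Complex.ofReal_re]; linarith⟩
    · rw [e2]
      exact ⟨Complex.ofReal_im _, by rw [Complex.ofReal_re]; linarith⟩
    · rw [phi2_eq, Complex.re_ofReal_mul, Complex.I_re, mul_zero]
    · rw [him]; linarith
  · have hlog : ∀ z : ℝ, 0 < z → z < 1 → 5/72 * (-Real.log z) ≤ RF (1/2) (1 - z) := by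
      intro z h0 h1
      have hs := (Real.hasSum_pow_div_log_of_abs_lt_one (x := 1 - z)
        (by rw [abs_of_pos (by linarith)]; linarith)).mul_left (5/72)
      rw [sub_sub_cancel] at hs
      have hz : 0 < 1 - z := by linarith
      have hsR := summable_RF (c := 1/2) le_rfl hz.le (by linarith)
      have h2 : RF (1/2) (1 - z) = 1 + ∑' n : ℕ, co (1/2) (n+1) * (1 - z) ^ (n+1) := by
        unfold RF
        rw [hsR.tsum_eq_zero_add, co_zero]; simp
      rw [h2, ← hs.tsum_eq]
      have hsR' : Summable (fun n : ℕ => co (1/2) (n+1) * (1 - z) ^ (n+1)) :=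
        (summable_nat_add_iff (f := fun n : ℕ => co (1/2) n * (1 - z) ^ n) 1).2 hsR
      have h3 := hs.summable.tsum_le_tsum (g := fun n : ℕ => co (1/2) (n+1) * (1 - z) ^ (n+1))
        (fun n => by
          have := mul_le_mul_of_nonneg_right (co_ge n) (pow_pos hz (n+1)).le
          refine le_trans (le_of_eq ?_) this
          ring) hsR'
      linarith
    have ht : Filter.Tendsto (fun z : ℝ => 2 * (5/72 * (-Real.log z)) - 1)
        (nhdsWithin 0 (Set.Ioo 0 1)) Filter.atTop := by
      have h := Real.tendsto_log_nhdsGT_zero.mono_left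
        (nhdsWithin_mono (0:ℝ) (fun x (hx : x ∈ Set.Ioo (0:ℝ) 1) => hx.1))
      have h' := Filter.tendsto_neg_atBot_atTop.comp h
      exact Filter.tendsto_atTop_add_const_right _ (-1)
        ((h'.const_mul_atTop (by norm_num : (0:ℝ) < 5/72)).const_mul_atTop two_pos)
    refine Filter.tendsto_atTop_mono' _ ?_ ht
    filter_upwards [self_mem_nhdsWithin] with z hz
    have := hlow z hz.1 hz.2
    have := hlog z hz.1 hz.2
    rw [him]
    linarith
  · have tid : Filter.Tendsto (fun z : ℝ => z) (nhdsWithin 1 (Set.Ioo 0 1)) (nhds 1) :=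
      Filter.tendsto_id.mono_left nhdsWithin_le_nhds
    have tB : Filter.Tendsto (fun z : ℝ => RF 1 z) (nhdsWithin 1 (Set.Ioo 0 1)) (nhds B1) := by
      rw [← hasSum_B1.tsum_eq]
      refine tendsto_tsum_of_dominated_convergence (bound := co 1) hasSum_B1.summable ?_ ?_
      · intro n
        simpa using (tid.pow n).const_mul (co 1 n)
      · filter_upwards [self_mem_nhdsWithin] with z hz n
        have hc := co_pos one_pos n
        rw [Real.norm_of_nonneg (mul_nonneg hc.le (pow_nonneg hz.1.le n))]
        exact mul_le_of_le_one_right hc.le (pow_le_one₀ hz.1.le hz.2.le)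
    have tA : Filter.Tendsto (fun z : ℝ => RF (1/2) (1 - z)) (nhdsWithin 1 (Set.Ioo 0 1))
        (nhds 1) := by
      have h1 : ∑' n : ℕ, co (1/2) n * (0:ℝ) ^ n = 1 := by
        rw [tsum_eq_single 0 (fun n hn => by simp [hn])]
        simp [co_zero]
      suffices hh : Filter.Tendsto (fun z : ℝ => RF (1/2) (1 - z)) (nhdsWithin 1 (Set.Ioo 0 1))
          (nhds (∑' n : ℕ, co (1/2) n * (0:ℝ) ^ n)) by rwa [h1] at hh
      refine tendsto_tsum_of_dominated_convergence (bound := fun n => (1/2 : ℝ) ^ n)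
        (summable_geometric_of_lt_one (by norm_num) (by norm_num)) ?_ ?_
      · intro n
        have := ((tid.const_sub 1).pow n).const_mul (co (1/2) n)
        rw [sub_self] at this
        exact this
      · have hev : ∀ᶠ z : ℝ in nhdsWithin 1 (Set.Ioo 0 1), 1/2 < z :=
          tid.eventually (lt_mem_nhds (by norm_num))
        filter_upwards [self_mem_nhdsWithin, hev] with z hz hz2 n
        have hc := co_pos (c := 1/2) (by norm_num) n
        have hz1 : 0 ≤ 1 - z := by linarith [hz.2]
        rw [Real.norm_of_nonneg (mul_nonneg hc.le (pow_nonneg hz1 n))]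
        refine (mul_le_of_le_one_left (pow_nonneg hz1 n) (co_le_one le_rfl n)).trans ?_
        exact pow_le_pow_left₀ hz1 (by linarith) n
    have t := ((tA.const_mul K).div tB hB.ne').sub_const 1
    rw [K_eq, show 2 * B1 * 1 / B1 - 1 = 1 by field_simp; norm_num] at t
    have t2 := ((Complex.continuous_ofReal.tendsto 1).comp t).mul_const Complex.I
    rw [Complex.ofReal_one, one_mul] at t2
    refine t2.congr fun z => ?_
    rw [phi2_eq, K_eq]
    rfl
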